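/- arXiv:1403.2056 — 5 statements merged into one kernel-verified Lean document; each statement's English description precedes it below -/
import Mathlib

section
/- Let p, s_a, s_b be strings with p ≤ s_a in the lexicographic order. If lcp(p,s_a) < lcp(p,s_b), then s_b < s_a in the lexicographic order (and symmetrically, if additionally p ≤ s_b and lcp(p,s_b) < lcp(p,s_a), then s_a < s_b). -/
/-- The length of the longest common prefix of two lists. -/
def lcp {α : Type*} [DecidableEq α] : List α → List α → ℕ
  | a :: s, b :: t => if a = b then lcp s t + 1 else 0
  | _, _ => 0

theorem lcp_aux {α : Type*} [LinearOrder α] (p : List α) : ∀ sa sb : List α,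
    p ≤ sa → lcp p sa < lcp p sb → sb < sa := by
  induction p with
  | nil => intro sa sb _ h; simp [lcp] at h
  | cons a p ih =>
    intro sa sb hle h
    cases sb with
    | nil => simp [lcp] at h
    | cons b sb =>
      cases sa with
      | nil => exact absurd hle (by simp)
      | cons c sa =>
        have hle : a < c ∨ a = c ∧ p ≤ sa := by
          rcases le_iff_lt_or_eq.mp hle with h1 | h1
          · rcases List.cons_lt_cons_iff.mp h1 with h2 | ⟨h2, h3⟩
            · exact Or.inl h2
            · exact Or.inr ⟨h2, le_of_lt h3⟩
          · injection h1 with h2 h3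
            exact Or.inr ⟨h2, le_of_eq h3⟩
        rw [List.cons_lt_cons_iff]
        simp only [lcp] at h
        by_cases hb : a = b
        · subst hb
          rcases hle with hc | ⟨hc, hps⟩
          · exact Or.inl hc
          · subst hc
            simp only [if_true] at h
            exact Or.inr ⟨rfl, ih _ _ hps (by omega)⟩
        · simp [hb] at h

/-- Let `p ≤ sa` in the lexicographic order.  If `lcp p sa < lcp p sb`, then
`sb < sa` lexicographically; symmetrically, if `p ≤ sb` and `lcp p sb < lcp p sa`,
then `sa < sb`. -/
theorem lt_of_lcp_lt {α : Type*} [LinearOrder α] (p sa sb : List α) :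
    (p ≤ sa → lcp p sa < lcp p sb → sb < sa) ∧
      (p ≤ sb → lcp p sb < lcp p sa → sa < sb) := by
  exact ⟨lcp_aux p sa sb, lcp_aux p sb sa⟩
end

section
/- Let h, w be natural numbers and let s and t be strings that share a common prefix of length h, each of length at least h+w; write chars_h(s) for the block of w characters of s at positions h+1,…,h+w, compared as a length-w string. Then: (i) if chars_h(s) = chars_h(t), then lcp(s,t) ≥ h + w; (ii) if chars_h(s) < chars_h(t) lexicographically, then s < t lexicographically; (iii) if x and y are length-w strings with x < chars_h(s) ≤ y and x < chars_h(t) ≤ y, then lcp(s,t) ≥ h + lcp(x,y). -/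
theorem blk_eq {α : Type*} [LinearOrder α] : ∀ (w : ℕ) (s t : List α),
    w ≤ s.length → w ≤ t.length → s.take w = t.take w → w ≤ lcp s t
  | 0, _, _, _, _, _ => Nat.zero_le _
  | w+1, [], _, hs, _, _ => by simp at hs
  | w+1, _::_, [], _, ht, _ => by simp at ht
  | w+1, a::s, b::t, hs, ht, h => by
    simp only [List.take_succ_cons, List.cons.injEq, List.length_cons] at h hs ht
    have := blk_eq w s t (by omega) (by omega) h.2
    simp only [lcp, h.1, if_true]
    omega

theorem blk_lt {α : Type*} [LinearOrder α] : ∀ (w : ℕ) (s t : List α),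
    s.take w < t.take w → s < t
  | 0, _, _, h => by simp at h
  | w+1, [], [], h => by simp at h
  | w+1, [], _::_, _ => by simp
  | w+1, _::_, [], h => by simp at h
  | w+1, a::s, b::t, h => by
    simp only [List.take_succ_cons, List.cons_lt_cons_iff] at h ⊢
    rcases h with h | ⟨h, h'⟩
    · exact Or.inl h
    · exact Or.inr ⟨h, blk_lt w s t h'⟩

theorem blk_lcp {α : Type*} [LinearOrder α] : ∀ (w : ℕ) (s t x y : List α),
    x.length = w → y.length = w → w ≤ s.length → w ≤ t.length →
    x < s.take w → ¬ y < s.take w → x < t.take w → ¬ y < t.take w →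
    lcp x y ≤ lcp s t
  | _, _, _, [], _, _, _, _, _, _, _, _, _ => by simp [lcp]
  | _, _, _, _::_, [], _, _, _, _, _, _, _, _ => by simp [lcp]
  | 0, _, _, _::_, _::_, hx, _, _, _, _, _, _, _ => by simp at hx
  | w+1, [], _, _::_, _::_, _, _, hs, _, _, _, _, _ => by simp at hs
  | w+1, _::_, [], _::_, _::_, _, _, _, ht, _, _, _, _ => by simp at ht
  | w+1, a::s, b::t, c::x, d::y, hx, hy, hs, ht, h1, h2, h3, h4 => by
    simp only [List.take_succ_cons, List.cons_lt_cons_iff, List.length_cons, not_or, not_and,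
      not_lt] at *
    by_cases hcd : c = d
    · subst hcd
      have e1 : c = a := by
        rcases h1 with h | h
        · exact absurd h (not_lt.2 h2.1)
        · exact h.1
      have e2 : c = b := by
        rcases h3 with h | h
        · exact absurd h (not_lt.2 h4.1)
        · exact h.1
      subst e1 e2
      simp only [lt_irrefl, false_or, true_and] at h1 h3
      have := blk_lcp w s t x y (by omega) (by omega) (by omega) (by omega) h1
        (not_lt.2 (h2.2 rfl)) h3 (not_lt.2 (h4.2 rfl))
      simpa [lcp] using this
    · simp [lcp, hcd]

theorem lcp_split {α : Type*} [LinearOrder α] : ∀ (h : ℕ) (s t : List α), h ≤ lcp s t →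
    lcp s t = h + lcp (s.drop h) (t.drop h) ∧ (s.drop h < t.drop h → s < t)
  | 0, _, _, _ => by simp
  | h+1, [], _, hh => by simp [lcp] at hh
  | h+1, _::_, [], hh => by simp [lcp] at hh
  | h+1, a::s, b::t, hh => by
    by_cases hab : a = b
    · subst hab
      simp only [lcp, if_true] at hh
      obtain ⟨h1, h2⟩ := lcp_split h s t (by omega)
      refine ⟨?_, ?_⟩
      · simp only [lcp, if_true, List.drop_succ_cons]
        omega
      · intro h3
        exact List.cons_lt_cons_iff.2 (Or.inr ⟨rfl, h2 h3⟩)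
    · simp [lcp, hab] at hh

/-- Correctness of one classification step of super scalar string sample sort.
Let `s` and `t` share a common prefix of length `h`, each of length at least `h + w`,
and write `(s.drop h).take w` for the block of `w` characters of `s` following
position `h` (the `chars_h` operation).  Then:
(i) if the blocks of `s` and `t` are equal, then `lcp s t ≥ h + w`;
(ii) if the block of `s` is lexicographically smaller than that of `t`, then `s < t`;
(iii) if `x` and `y` are strings of length `w` with `x <` block `≤ y` for the blocks
of both `s` and `t`, then `lcp s t ≥ h + lcp x y`. -/
theorem sample_sort_classification {α : Type*} [LinearOrder α]
    (h w : ℕ) (s t : List α)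
    (hs : h + w ≤ s.length) (ht : h + w ≤ t.length)
    (hcommon : h ≤ lcp s t) :
    ((s.drop h).take w = (t.drop h).take w → h + w ≤ lcp s t) ∧
    ((s.drop h).take w < (t.drop h).take w → s < t) ∧
    (∀ x y : List α, x.length = w → y.length = w →
      x < (s.drop h).take w → (s.drop h).take w ≤ y →
      x < (t.drop h).take w → (t.drop h).take w ≤ y →
      h + lcp x y ≤ lcp s t) := by
  obtain ⟨h1, h2⟩ := lcp_split h s t hcommon
  have hs' : w ≤ (s.drop h).length := by
    rw [List.length_drop]
    omega
  have ht' : w ≤ (t.drop h).length := by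
    rw [List.length_drop]
    omega
  rw [h1]
  refine ⟨fun e => ?_, fun e => h2 (blk_lt w _ _ e), fun x y hx hy a b c d => ?_⟩
  · exact Nat.add_le_add_left (blk_eq w _ _ hs' ht' e) h
  · exact Nat.add_le_add_left (blk_lcp w _ _ x y hx hy hs' ht' a (not_lt.2 b) c (not_lt.2 d)) h
end

section
/- Let S = ⟨s_1 ≤ ⋯ ≤ s_n⟩ be a lexicographically sorted sequence of strings (n ≥ 2) with LCP array H = ⟨h_2,…,h_n⟩, and let m = min_{2 ≤ i ≤ n} h_i be the global minimum of the LCP array. Partition the index range 1..n into maximal consecutive areas separated by the positions i with h_i = m. Then any two strings within the same area have lcp strictly greater than m (in particular they share a common prefix of length m+1), while any two strings from different areas have lcp exactly m. -/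
theorem lcp_cons_le {α : Type*} [LinearOrder α] {a b : α} {x y : List α}
    (h : a :: x ≤ b :: y) : a < b ∨ a = b ∧ x ≤ y := by
  rcases lt_trichotomy a b with hab | rfl | hab
  · exact Or.inl hab
  · refine Or.inr ⟨rfl, not_lt.1 fun hyx => ?_⟩
    exact absurd (List.Lex.cons hyx : List.Lex (· < ·) (a :: y) (a :: x)) (not_lt.2 h)
  · exact absurd (List.Lex.rel hab : List.Lex (· < ·) (b :: y) (a :: x)) (not_lt.2 h)

theorem lcp_trichain {α : Type*} [LinearOrder α] : ∀ (x y z : List α), x ≤ y → y ≤ z →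
    lcp x z = min (lcp x y) (lcp y z)
  | [], _, _ => by intros; simp [lcp]
  | a :: x, [], z => by
    intro h
    exact absurd (List.Lex.nil : List.Lex (· < ·) [] (a :: x)) (not_lt.2 h)
  | a :: x, b :: y, [] => by
    intro _ h
    exact absurd (List.Lex.nil : List.Lex (· < ·) [] (b :: y)) (not_lt.2 h)
  | a :: x, b :: y, c :: z => by
    intro h1 h2
    replace h1 := lcp_cons_le h1
    replace h2 := lcp_cons_le h2
    have ih := lcp_trichain x y z
    simp only [lcp]
    rcases h1 with h1 | ⟨rfl, h1⟩
    · rcases h2 with h2 | ⟨rfl, h2⟩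
      · simp [h1.ne, h2.ne, (h1.trans h2).ne]
      · simp [h1.ne]
    · rcases h2 with h2 | ⟨rfl, h2⟩
      · simp [h2.ne]
      · simp only [if_true]
        rw [ih h1 h2]
        omega

theorem lcp_range {α : Type*} [LinearOrder α] (n : ℕ) (s : ℕ → List α)
    (hs : ∀ i, i + 1 < n → s i ≤ s (i + 1)) (a d : ℕ) (h : a + d + 1 < n) :
    s a ≤ s (a + d + 1) ∧ ∀ t, t ≤ lcp (s a) (s (a + d + 1)) ↔
      ∀ k ∈ Finset.Ioc a (a + d + 1), t ≤ lcp (s (k - 1)) (s k) := by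
  induction d with
  | zero =>
    refine ⟨hs _ h, fun t => ?_⟩
    simp
  | succ d ih =>
    obtain ⟨h1, h2⟩ := ih (by omega)
    have h3 := hs (a + d + 1) h
    refine ⟨le_trans h1 h3, fun t => ?_⟩
    change t ≤ lcp (s a) (s (a + d + 1 + 1)) ↔ _
    rw [lcp_trichain _ _ _ h1 h3, le_min_iff, h2]
    constructor
    · rintro ⟨h4, h5⟩ k hk
      rw [Finset.mem_Ioc] at hk
      by_cases hk' : k = a + d + 1 + 1
      · subst hk'; exact h5
      · exact h4 k (Finset.mem_Ioc.2 (by omega))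
    · intro h4
      refine ⟨fun k hk => h4 k ?_, ?_⟩
      · rw [Finset.mem_Ioc] at hk ⊢; omega
      · exact h4 (a + d + 1 + 1) (Finset.mem_Ioc.2 (by omega))

/-- Let `s 0 ≤ ⋯ ≤ s (n-1)` (with `n ≥ 2`) be a lexicographically sorted sequence of
strings with LCP array `H k = lcp (s (k-1)) (s k)` for `1 ≤ k < n`, and let `m` be the
global minimum of the LCP array.  The occurrences of `m` in the LCP array split the
index range into maximal consecutive areas.  Two indices `a < b` lie in the same area
iff no `k` with `a < k ≤ b` has `H k = m`.  Then any two strings within the same area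
have lcp strictly greater than `m` (in particular they share a common prefix of length
`m + 1`), while any two strings from different areas have lcp exactly `m`. -/
theorem lcp_min_split {α : Type*} [LinearOrder α]
    (n : ℕ) (hn : 2 ≤ n) (s : ℕ → List α)
    (hsorted : ∀ i, i + 1 < n → s i ≤ s (i + 1))
    (m : ℕ)
    (hm : m = (Finset.Ico 1 n).inf' (Finset.nonempty_Ico.mpr (by omega))
      (fun k => lcp (s (k - 1)) (s k)))
    (a b : ℕ) (hab : a < b) (hbn : b < n) :
    ((∀ k ∈ Finset.Ioc a b, lcp (s (k - 1)) (s k) ≠ m) → m < lcp (s a) (s b)) ∧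
    ((∃ k ∈ Finset.Ioc a b, lcp (s (k - 1)) (s k) = m) → lcp (s a) (s b) = m) := by
  obtain ⟨d, rfl⟩ : ∃ d, b = a + d + 1 := ⟨b - a - 1, by omega⟩
  obtain ⟨-, H⟩ := lcp_range n s hsorted a d hbn
  have hmin : ∀ k ∈ Finset.Ioc a (a + d + 1), m ≤ lcp (s (k - 1)) (s k) := by
    intro k hk
    rw [Finset.mem_Ioc] at hk
    rw [hm]
    exact Finset.inf'_le (fun k => lcp (s (k - 1)) (s k)) (Finset.mem_Ico.2 (by omega))
  constructor
  · intro h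
    exact (H (m + 1)).2 fun k hk => lt_of_le_of_ne (hmin k hk) (h k hk).symm
  · rintro ⟨k, hk, hkm⟩
    exact le_antisymm (hkm ▸ (H _).1 le_rfl k hk) ((H m).2 hmin)
end

section
/- For any finite set of strings {s_1,…,s_n} with distinguishing prefix size D and with L = Σ_{i=2}^n h_i the sum of the LCP array H of the lexicographically sorted order of the strings, one has L ≤ D. -/
/-- The distinguishing prefix size `D` of the strings `s 0, …, s (n-1)`:
`D = Σ_i min (|s i|) (1 + max_{j ≠ i} lcp (s i) (s j))`, the total number of
characters that must be inspected to establish the lexicographic ordering. -/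
def distPrefixSize {α : Type*} [LinearOrder α] (n : ℕ) (s : ℕ → List α) : ℕ :=
  ∑ i ∈ Finset.range n,
    min (s i).length (1 + ((Finset.range n).erase i).sup fun j => lcp (s i) (s j))

theorem lcp_comm_aux {α : Type*} [DecidableEq α] (s t : List α) : lcp s t = lcp t s := by
  induction s generalizing t with
  | nil => cases t <;> simp [lcp]
  | cons a s ih =>
    cases t with
    | nil => simp [lcp]
    | cons b t => simp only [lcp, ih t, eq_comm]

theorem lcp_le_length_aux {α : Type*} [DecidableEq α] (s t : List α) : lcp s t ≤ s.length := by
  induction s generalizing t with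
  | nil => cases t <;> simp [lcp]
  | cons a s ih =>
    cases t with
    | nil => simp [lcp]
    | cons b t =>
      have := ih t
      simp only [lcp, List.length_cons]
      split_ifs <;> omega

/-- For any finite set of strings, listed in lexicographically sorted order as
`s 0 ≤ ⋯ ≤ s (n-1)`, the sum `L = Σ_{i=1}^{n-1} lcp (s (i-1)) (s i)` of the entries
of the LCP array is at most the distinguishing prefix size `D`. -/
theorem lcp_sum_le_distPrefixSize {α : Type*} [LinearOrder α]
    (n : ℕ) (s : ℕ → List α)
    (hsorted : ∀ i, i + 1 < n → s i ≤ s (i + 1)) :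
    ∑ i ∈ Finset.Ico 1 n, lcp (s (i - 1)) (s i) ≤ distPrefixSize n s := by
  unfold distPrefixSize
  refine le_trans (Finset.sum_le_sum (fun i hi => ?_))
    (Finset.sum_le_sum_of_subset (s := Finset.Ico 1 n) (fun i hi => ?_))
  · rw [Finset.mem_Ico] at hi
    rw [lcp_comm_aux]
    refine le_min (lcp_le_length_aux _ _) ?_
    have hm : i - 1 ∈ (Finset.range n).erase i := by
      rw [Finset.mem_erase, Finset.mem_range]; omega
    have h := Finset.le_sup (f := fun j => lcp (s i) (s j)) hm
    exact le_trans h (Nat.le_add_left _ _)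
  · rw [Finset.mem_Ico] at hi
    rw [Finset.mem_range]; omega
end

section
/- Binary LCP-compare is correct: let p, s_a, s_b be strings with p ≤ s_a and p ≤ s_b in the lexicographic order, and let h_a = lcp(p,s_a) and h_b = lcp(p,s_b). Then: (1) if h_a < h_b, then s_b < s_a and lcp(s_a,s_b) = h_a; (2) if h_b < h_a, then s_a < s_b and lcp(s_a,s_b) = h_b; (3) if h_a = h_b = h, then lcp(s_a,s_b) ≥ h, and the lexicographic order of s_a and s_b is decided by comparing their characters from position h+1 onward, the number of additionally matching characters being exactly lcp(s_a,s_b) − h. -/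
theorem lt_cons {α : Type*} [LinearOrder α] (a b : α) (s t : List α) :
    a :: s < b :: t ↔ a < b ∨ a = b ∧ s < t := List.cons_lt_cons_iff

theorem le_cons {α : Type*} [LinearOrder α] (a b : α) (s t : List α) :
    a :: s ≤ b :: t ↔ a < b ∨ a = b ∧ s ≤ t := by
  rw [← not_lt, ← not_lt, lt_cons]
  rcases lt_trichotomy a b with h | h | h
  · simp [h, h.not_gt, h.ne, h.ne']
  · simp [h]
  · simp [h, h.not_gt, h.ne, h.ne']

/-- Correctness of binary LCP-compare: let `p ≤ sa` and `p ≤ sb` lexicographically,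
with `h_a = lcp p sa` and `h_b = lcp p sb`.  Then:
(1) if `h_a < h_b` then `sb < sa` and `lcp sa sb = h_a`;
(2) if `h_b < h_a` then `sa < sb` and `lcp sa sb = h_b`;
(3) if `h_a = h_b = h`, then `lcp sa sb ≥ h`, the order of `sa` and `sb` is decided
by comparing the suffixes from position `h+1` onward, and the number of additionally
matching characters is exactly `lcp sa sb − h`. -/
theorem lcp_compare_correct {α : Type*} [LinearOrder α]
    (p sa sb : List α) (hpa : p ≤ sa) (hpb : p ≤ sb) :
    (lcp p sa < lcp p sb → sb < sa ∧ lcp sa sb = lcp p sa) ∧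
    (lcp p sb < lcp p sa → sa < sb ∧ lcp sa sb = lcp p sb) ∧
    (∀ h : ℕ, lcp p sa = h → lcp p sb = h →
      h ≤ lcp sa sb ∧ (sa ≤ sb ↔ sa.drop h ≤ sb.drop h) ∧
        lcp (sa.drop h) (sb.drop h) = lcp sa sb - h) := by
  induction p generalizing sa sb with
  | nil => simp [lcp]
  | cons x p ih =>
    cases sa with
    | nil => exact absurd hpa (by simp [← not_lt])
    | cons a s =>
    cases sb with
    | nil => exact absurd hpb (by simp [← not_lt])
    | cons b t =>
    rw [le_cons] at hpa hpb
    by_cases hxa : x = a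
    · subst hxa
      by_cases hxb : x = b
      · subst hxb
        simp only [lt_irrefl, true_and, false_or] at hpa hpb
        obtain ⟨h1, h2, h3⟩ := ih s t hpa hpb
        simp only [lcp, if_true, lt_cons, le_cons, lt_irrefl, true_and, false_or,
          add_lt_add_iff_right, add_left_inj]
        refine ⟨h1, h2, ?_⟩
        rintro h rfl h'
        obtain ⟨k1, k2, k3⟩ := h3 _ rfl (by omega)
        simp only [List.drop_succ_cons]
        exact ⟨by omega, k2, by omega⟩
      · have hb : x < b := by tauto
        simp only [lcp, if_true, hxb, if_false, lt_cons, le_cons]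
        refine ⟨by omega, fun _ => ⟨Or.inl hb, trivial⟩, by omega⟩
    · have ha : x < a := by tauto
      by_cases hxb : x = b
      · subst hxb
        simp only [lcp, if_true, hxa, Ne.symm hxa, if_false, lt_cons, le_cons]
        refine ⟨fun _ => ⟨Or.inl ha, by simp⟩, by omega, by omega⟩
      · simp only [lcp, hxa, hxb, if_false]
        refine ⟨by omega, by omega, ?_⟩
        rintro h rfl -
        simp [lcp]
end
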